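/- The linearisation map Aut(F_2) → GL_2(ℤ) (induced by abelianization of F_2) induces an isomorphism on abelianizations: Aut(F_2)_ab ≅ GL_2(ℤ)_ab. -/

import Mathlib

/-- The automorphism of the abelianization induced by an automorphism of `G`. -/
noncomputable def abelianizationCongr' {G : Type*} [Group G] (φ : G ≃* G) :
    Abelianization G ≃* Abelianization G :=
  MonoidHom.toMulEquiv (Abelianization.map φ.toMonoidHom) (Abelianization.map φ.symm.toMonoidHom)
    (by apply Abelianization.hom_ext; ext g; simp [Abelianization.map_of])
    (by apply Abelianization.hom_ext; ext g; simp [Abelianization.map_of])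

/-- The "linearisation" homomorphism `Aut(G) → Aut(G_ab)`.  For `G = F_2` the target
`Aut((F_2)_ab) = Aut(ℤ²)` is `GL_2(ℤ)`. -/
noncomputable def linAb (G : Type*) [Group G] : MulAut G →* MulAut (Abelianization G) where
  toFun φ := abelianizationCongr' φ
  map_one' := by
    apply MulEquiv.toMonoidHom_injective
    apply Abelianization.hom_ext
    ext g
    simp [abelianizationCongr', Abelianization.map_of]
  map_mul' φ ψ := by
    apply MulEquiv.toMonoidHom_injective
    apply Abelianization.hom_ext
    ext g
    simp [abelianizationCongr', Abelianization.map_of]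


namespace AutF2

open FreeGroup hiding map_mul map_one map_inv

/-- Length of the longest common prefix of two lists. -/
def lcp {β : Type*} [DecidableEq β] : List β → List β → ℕ
  | a :: l, b :: m => if a = b then lcp l m + 1 else 0
  | _, _ => 0

lemma lcp_comm {β : Type*} [DecidableEq β] (l m : List β) : lcp l m = lcp m l := by
  induction l generalizing m with
  | nil => cases m <;> simp [lcp]
  | cons a l ih =>
    cases m with
    | nil => simp [lcp]
    | cons b m => simp only [lcp, ih m, eq_comm]

lemma lcp_hyp {β : Type*} [DecidableEq β] (l m n : List β) :
    lcp l m ≤ lcp l n ∨ lcp m n ≤ lcp l n := by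
  induction l generalizing m n with
  | nil => left; simp [lcp]
  | cons a l ih =>
    cases m with
    | nil => left; simp [lcp]
    | cons b m =>
      cases n with
      | nil => right; simp [lcp]
      | cons c n =>
        have := ih m n
        simp only [lcp]
        by_cases h1 : a = b
        · subst h1
          by_cases h2 : a = c
          · subst h2; simpa using this
          · simp [h2]
        · simp [h1]

lemma length_lcp {α : Type*} [DecidableEq α] (l m : List (α × Bool)) (hl : IsReduced l)
    (hm : IsReduced m) :
    FreeGroup.norm ((mk l)⁻¹ * mk m) + 2 * lcp l m = l.length + m.length := by
  induction l generalizing m with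
  | nil =>
    simp [lcp, ← one_eq_mk, FreeGroup.norm, hm.reduce_eq]
  | cons a l ih =>
    cases m with
    | nil =>
      rw [← one_eq_mk, mul_one, norm_inv_eq]; simp [lcp, FreeGroup.norm, hl.reduce_eq]
    | cons b m =>
      by_cases h : a = b
      · subst h
        have h1 := ih m (hl.infix ⟨[a], [], by simp⟩) (hm.infix ⟨[a], [], by simp⟩)
        have h2 : (mk (a :: l))⁻¹ * mk (a :: m) = (mk l)⁻¹ * mk m := by
          have e1 : mk (a :: l) = mk [a] * mk l := by rw [mul_mk]; rfl
          have e2 : mk (a :: m) = mk [a] * mk m := by rw [mul_mk]; rfl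
          rw [e1, e2]; group
        rw [h2]
        simp only [lcp, if_true, List.length_cons]
        omega
      · have h3 : IsReduced (invRev (a :: l) ++ (b :: m)) := by
          have h4 : IsReduced (invRev (a :: l)) := by
            rw [isReduced_iff_reduce_eq, reduce_invRev, hl.reduce_eq]
          rw [invRev_cons] at h4 ⊢
          refine IsReduced.append_overlap h4 ?_ (by simp [invRev])
          simp only [invRev, List.map_cons, List.map_nil, List.reverse_cons, List.reverse_nil,
            List.nil_append, List.cons_append]
          rw [FreeGroup.isReduced_cons_cons]
          refine ⟨?_, hm⟩
          intro h5
          by_contra h6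
          apply h
          ext
          · exact h5
          · revert h6; simp
        rw [inv_mk, mul_mk, FreeGroup.norm, toWord_mk, h3.reduce_eq]
        simp [lcp, h]

/-- Gromov product. -/
def gp {α : Type*} [DecidableEq α] (x y : FreeGroup α) : ℕ := lcp x.toWord y.toWord

lemma norm_gp {α : Type*} [DecidableEq α] (x y : FreeGroup α) :
    FreeGroup.norm (x⁻¹ * y) + 2 * gp x y = FreeGroup.norm x + FreeGroup.norm y := by
  have := length_lcp x.toWord y.toWord isReduced_toWord isReduced_toWord
  rwa [mk_toWord, mk_toWord] at this

lemma gp_hyp {α : Type*} [DecidableEq α] (x y z : FreeGroup α) :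
    gp x y ≤ gp x z ∨ gp y z ≤ gp x z := lcp_hyp _ _ _

lemma gp_comm {α : Type*} [DecidableEq α] (x y : FreeGroup α) : gp x y = gp y x := lcp_comm _ _

lemma norm_sq {α : Type*} [DecidableEq α] (x : FreeGroup α) (hx : x ≠ 1) :
    FreeGroup.norm x < FreeGroup.norm (x * x) := by
  have h1 := reduceCyclically.reduce_flatten_replicate_succ (L := x.toWord) isReduced_toWord 1
  have h2 := reduceCyclically.conj_conjugator_reduceCyclically x.toWord
  have h3 : (x * x).toWord = reduce (List.replicate (1 + 1) x.toWord).flatten := by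
    rw [← pow_two, toWord_pow]
  have h4 : reduceCyclically x.toWord ≠ [] := by
    intro h
    rw [h] at h2
    apply hx
    have := congrArg mk h2
    rw [mk_toWord] at this
    rw [← this]
    simp [← mul_mk, ← inv_mk]
  have h5 := congrArg List.length h2
  have h6 := List.length_pos_iff.mpr h4
  simp only [FreeGroup.norm]
  rw [h3, h1, ← h5]
  simp
  omega

lemma split {α : Type*} [DecidableEq α] (x : FreeGroup α) (k l : ℕ) (h : FreeGroup.norm x = k + l) :
    ∃ p s, x = p * s ∧ FreeGroup.norm p = k ∧ FreeGroup.norm s = l := by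
  refine ⟨mk (x.toWord.take k), mk (x.toWord.drop k), ?_, ?_, ?_⟩
  · rw [mul_mk, List.take_append_drop, mk_toWord]
  · have : IsReduced (x.toWord.take k) :=
      isReduced_toWord.infix (List.take_prefix k x.toWord).isInfix
    rw [FreeGroup.norm, toWord_mk, this.reduce_eq]
    simp only [FreeGroup.norm] at h
    simp; omega
  · have : IsReduced (x.toWord.drop k) :=
      isReduced_toWord.infix (List.drop_suffix k x.toWord).isInfix
    rw [FreeGroup.norm, toWord_mk, this.reduce_eq]
    simp only [FreeGroup.norm] at h
    simp; omega

abbrev F := FreeGroup (Fin 2)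

/-- The relation on letters: `x` and `y` are not mutually inverse. -/
abbrev ok (x y : Fin 2 × Bool) : Prop := x.1 = y.1 → x.2 = y.2

lemma reduced_norm (φ : MulAut F)
    (N1 : ∀ x y : Fin 2 × Bool, ok x y →
      FreeGroup.norm (φ (mk [x])) ≤ FreeGroup.norm (φ (mk [x]) * φ (mk [y])) ∧
      FreeGroup.norm (φ (mk [y])) ≤ FreeGroup.norm (φ (mk [x]) * φ (mk [y])))
    (N2 : ∀ x y z : Fin 2 × Bool, ok x y → ok y z →
      gp (φ (mk [x]))⁻¹ (φ (mk [y])) + gp (φ (mk [y]))⁻¹ (φ (mk [z])) <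
        FreeGroup.norm (φ (mk [y])))
    (l : List (Fin 2 × Bool)) : ∀ y, FreeGroup.IsReduced (y :: l) →
      (∀ x ∈ y :: l, FreeGroup.norm (φ (mk [x])) ≤ FreeGroup.norm (φ (mk (y :: l)))) ∧
      (∀ t, ok t y → gp (φ (mk [t]))⁻¹ (φ (mk (y :: l))) ≤ gp (φ (mk [t]))⁻¹ (φ (mk [y]))) := by
  induction l with
  | nil => intro y _; simp
  | cons y l ih =>
    intro z hz
    rw [isReduced_cons_cons] at hz
    obtain ⟨hzy, hy⟩ := hz
    obtain ⟨ha, hb⟩ := ih y hy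
    have e : φ (mk (z :: y :: l)) = φ (mk [z]) * φ (mk (y :: l)) := by
      rw [← map_mul, mul_mk]; rfl
    have hyl := ha y (by simp)
    rw [e]
    set W := φ (mk (y :: l)) with hW
    have h1 := hb z hzy
    have h2 := norm_gp (φ (mk [z]))⁻¹ W
    have h3 := norm_gp (φ (mk [z]))⁻¹ (φ (mk [y]))
    have h4 := N1 z y hzy
    rw [inv_inv, norm_inv_eq] at h2 h3
    refine ⟨?_, ?_⟩
    · intro x hx
      rcases List.mem_cons.mp hx with rfl | hx
      · omega
      · have := ha x hx
        omega
    · intro t ht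
      have h5 := N2 t z y ht hzy
      have h6 := norm_gp (φ (mk [z]) * W) (φ (mk [z]))
      have e2 : (φ (mk [z]) * W)⁻¹ * φ (mk [z]) = W⁻¹ := by group
      rw [e2, norm_inv_eq] at h6
      rcases gp_hyp (φ (mk [t]))⁻¹ (φ (mk [z]) * W) (φ (mk [z])) with h | h <;> omega

/-- An automorphism of `F` from the images of the generators (and of its inverse). -/
def mkAut (u v u' v' : F)
    (h0 : FreeGroup.lift ![u', v'] u = of 0) (h1 : FreeGroup.lift ![u', v'] v = of 1)
    (h2 : FreeGroup.lift ![u, v] u' = of 0) (h3 : FreeGroup.lift ![u, v] v' = of 1) : MulAut F :=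
  MonoidHom.toMulEquiv (FreeGroup.lift ![u, v]) (FreeGroup.lift ![u', v'])
    (by ext i; fin_cases i <;> simp [h0, h1])
    (by ext i; fin_cases i <;> simp [h2, h3])

@[simp] lemma mkAut_0 (u v u' v' : F) (h0 h1 h2 h3) : mkAut u v u' v' h0 h1 h2 h3 (of 0) = u := by
  simp [mkAut]

@[simp] lemma mkAut_1 (u v u' v' : F) (h0 h1 h2 h3) : mkAut u v u' v' h0 h1 h2 h3 (of 1) = v := by
  simp [mkAut]

lemma aut_ext {φ ψ : MulAut F} (h0 : φ (of 0) = ψ (of 0)) (h1 : φ (of 1) = ψ (of 1)) : φ = ψ := by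
  apply MulEquiv.toMonoidHom_injective
  ext i
  fin_cases i
  · exact h0
  · exact h1

def sg : MulAut F := mkAut (of 0)⁻¹ (of 1) (of 0)⁻¹ (of 1) (by simp) (by simp) (by simp) (by simp)
def pp : MulAut F := mkAut (of 1) (of 0) (of 1) (of 0) (by simp) (by simp) (by simp) (by simp)
def uu : MulAut F := mkAut (of 0 * of 1) (of 1) (of 0 * (of 1)⁻¹) (of 1)
  (by simp) (by simp) (by simp) (by simp)

@[simp] lemma sg0 : sg (of 0) = (of 0)⁻¹ := mkAut_0 ..
@[simp] lemma sg1 : sg (of 1) = of 1 := mkAut_1 ..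
@[simp] lemma pp0 : pp (of 0) = of 1 := mkAut_0 ..
@[simp] lemma pp1 : pp (of 1) = of 0 := mkAut_1 ..
@[simp] lemma uu0 : uu (of 0) = of 0 * of 1 := mkAut_0 ..
@[simp] lemma uu1 : uu (of 1) = of 1 := mkAut_1 ..

lemma sg_sq : sg * sg = 1 := by apply aut_ext <;> simp
lemma pp_sq : pp * pp = 1 := by apply aut_ext <;> simp
lemma uu_rel : (pp * sg * pp) * uu * (pp * sg * pp) * uu = 1 := by apply aut_ext <;> simp

abbrev cl : MulAut F →* Abelianization (MulAut F) := Abelianization.of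

lemma cl_sg : cl sg * cl sg = 1 := by rw [← map_mul, sg_sq, map_one]
lemma cl_pp : cl pp * cl pp = 1 := by rw [← map_mul, pp_sq, map_one]
lemma cl_uu : cl uu * cl uu = 1 := by
  have h := congrArg cl uu_rel
  simp only [map_mul, map_one] at h
  calc cl uu * cl uu = (cl uu * cl uu) * (cl pp * cl pp) * (cl pp * cl pp) * (cl sg * cl sg) := by
        rw [cl_pp, cl_sg]; simp
    _ = cl pp * cl sg * cl pp * cl uu * (cl pp * cl sg * cl pp) * cl uu := by
        simp only [mul_comm, mul_left_comm]
    _ = 1 := h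

lemma conj_mul (φ : MulAut F) (g : F) : φ * MulAut.conj g * φ⁻¹ = MulAut.conj (φ g) := by
  ext x; simp [MulAut.conj_apply]

lemma cl_conj (g : F) : cl (MulAut.conj g) = 1 := by
  have key (φ : MulAut F) (g : F) : cl (MulAut.conj (φ g)) = cl (MulAut.conj g) := by
    rw [← conj_mul, map_mul, map_mul, map_inv, mul_comm, inv_mul_cancel_left]
  have h1 := key uu (of 0)
  have h2 := key pp (of 0)
  rw [uu0, map_mul, map_mul] at h1
  rw [pp0] at h2
  have h3 : cl (MulAut.conj (of (1 : Fin 2))) = 1 := by simpa using h1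
  have : (cl.comp MulAut.conj : F →* _) = 1 := by
    ext i
    fin_cases i
    · exact h2.symm.trans h3
    · exact h3
  exact DFunLike.congr_fun this g

lemma pp_rel : (pp * uu * pp) * (sg * uu * sg) * (pp * uu * pp) =
    MulAut.conj (of 0)⁻¹ * (pp * sg) := by
  apply aut_ext <;> simp [mul_assoc]

lemma comm_aux {A : Type*} [CommGroup A] (p u s : A) :
    p * u * p * (s * u * s) * (p * u * p) * s =
      (p * p) * (p * p) * (s * s) * (u * u) * (u * s) := by
  ac_rfl

lemma cl_pp_eq : cl pp = cl uu * cl sg := by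
  have h := congrArg cl pp_rel
  rw [map_mul cl (MulAut.conj _), cl_conj, one_mul] at h
  simp only [map_mul] at h
  calc cl pp = (cl pp * cl sg) * cl sg := by rw [mul_assoc, cl_sg, mul_one]
    _ = cl pp * cl uu * cl pp * (cl sg * cl uu * cl sg) * (cl pp * cl uu * cl pp) * cl sg := by
      rw [← h]
    _ = (cl pp * cl pp) * (cl pp * cl pp) * (cl sg * cl sg) * (cl uu * cl uu) *
          (cl uu * cl sg) := comm_aux _ _ _
    _ = cl uu * cl sg := by rw [cl_pp, cl_sg, cl_uu]; simp

/-- The subgroup of automorphisms whose class is generated by those of `sg` and `uu`. -/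
def E : Subgroup (MulAut F) := (Subgroup.closure {cl sg, cl uu}).comap cl

lemma sg_mem : sg ∈ E := Subgroup.subset_closure (by simp)
lemma uu_mem : uu ∈ E := Subgroup.subset_closure (by simp)
lemma pp_mem : pp ∈ E := by
  have : cl pp ∈ Subgroup.closure {cl sg, cl uu} := by
    rw [cl_pp_eq, ← map_mul]
    exact mul_mem uu_mem sg_mem
  exact this
lemma conj_mem (g : F) : MulAut.conj g ∈ E := by
  have : cl (MulAut.conj g) ∈ Subgroup.closure {cl sg, cl uu} := by
    rw [cl_conj]; exact one_mem _
  exact this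

lemma mk_true (i : Fin 2) : mk [(i, true)] = of i := rfl
lemma mk_false (i : Fin 2) : mk [(i, false)] = (of i)⁻¹ := rfl

lemma signed (x y : Fin 2 × Bool) (h : x.1 ≠ y.1) :
    ∃ π ∈ E, π (of 0) = mk [x] ∧ π (of 1) = mk [y] := by
  have hs := sg_mem
  have hp := pp_mem
  have ht : pp * sg * pp ∈ E := mul_mem (mul_mem hp hs) hp
  obtain ⟨i, b⟩ := x
  obtain ⟨j, c⟩ := y
  fin_cases i <;> fin_cases j <;> first | (exact absurd rfl h) | skip
  · cases b <;> cases c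
    · exact ⟨sg * (pp * sg * pp), mul_mem hs ht, by simp [mk_false], by simp [mk_false]⟩
    · exact ⟨sg, hs, by simp [mk_false], by simp [mk_true]⟩
    · exact ⟨pp * sg * pp, ht, by simp [mk_true], by simp [mk_false]⟩
    · exact ⟨1, one_mem _, by simp [mk_true], by simp [mk_true]⟩
  · cases b <;> cases c
    · exact ⟨pp * (sg * (pp * sg * pp)), mul_mem hp (mul_mem hs ht), by simp [mk_false],
        by simp [mk_false]⟩
    · exact ⟨pp * sg, mul_mem hp hs, by simp [mk_false], by simp [mk_true]⟩
    · exact ⟨pp * (pp * sg * pp), mul_mem hp ht, by simp [mk_true], by simp [mk_false]⟩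
    · exact ⟨pp, hp, by simp [mk_true], by simp [mk_true]⟩

/-- Total length of the images of the generators. -/
def meas (φ : MulAut F) : ℕ := FreeGroup.norm (φ (of 0)) + FreeGroup.norm (φ (of 1))

lemma norm_letter (φ : MulAut F) (x : Fin 2 × Bool) :
    FreeGroup.norm (φ (mk [x])) = FreeGroup.norm (φ (of x.1)) := by
  obtain ⟨i, b⟩ := x
  cases b
  · rw [mk_false, map_inv, norm_inv_eq]
  · rfl

lemma meas_letters (φ : MulAut F) (x y : Fin 2 × Bool) (h : x.1 ≠ y.1) :
    FreeGroup.norm (φ (mk [x])) + FreeGroup.norm (φ (mk [y])) = meas φ := by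
  rw [norm_letter, norm_letter, meas]
  obtain ⟨i, b⟩ := x
  obtain ⟨j, c⟩ := y
  fin_cases i <;> fin_cases j <;> first | (exact absurd rfl h) | skip
  · rfl
  · exact add_comm _ _

def Minimal (φ : MulAut F) : Prop := ∀ e₁ ∈ E, ∀ e₂ ∈ E, meas φ ≤ meas (e₁ * φ * e₂)

lemma Minimal.pair {φ : MulAut F} (hφ : Minimal φ) (x y : Fin 2 × Bool) (h : x.1 ≠ y.1) (s : F) :
    FreeGroup.norm (φ (mk [x])) + FreeGroup.norm (φ (mk [y])) ≤
      FreeGroup.norm (s * (φ (mk [x]) * φ (mk [y])) * s⁻¹) +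
        FreeGroup.norm (s * φ (mk [y]) * s⁻¹) := by
  obtain ⟨π, hπ, h0, h1⟩ := signed x y h
  have := hφ (MulAut.conj s) (conj_mem s) (π * uu) (mul_mem hπ uu_mem)
  rw [meas_letters φ x y h]
  refine this.trans (le_of_eq ?_)
  simp [meas, h0, h1, -mul_mk]

lemma letter_ne (φ : MulAut F) (x : Fin 2 × Bool) : φ (mk [x]) ≠ 1 := by
  intro h
  have h1 : mk [x] = (1 : F) := by simpa using h
  have := congrArg toWord h1
  simp at this

lemma Minimal.N1 {φ : MulAut F} (hφ : Minimal φ) (x y : Fin 2 × Bool) (h : ok x y) :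
      FreeGroup.norm (φ (mk [x])) ≤ FreeGroup.norm (φ (mk [x]) * φ (mk [y])) ∧
      FreeGroup.norm (φ (mk [y])) ≤ FreeGroup.norm (φ (mk [x]) * φ (mk [y])) := by
  by_cases hxy : x.1 = y.1
  · have : x = y := Prod.ext hxy (h hxy)
    subst this
    have := norm_sq _ (letter_ne φ x)
    omega
  · have key : ∀ x y : Fin 2 × Bool, x.1 ≠ y.1 →
        FreeGroup.norm (φ (mk [x])) ≤ FreeGroup.norm (φ (mk [x]) * φ (mk [y])) := by
      intro x y h
      have := hφ.pair x y h 1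
      simp only [one_mul, inv_one, mul_one] at this
      omega
    refine ⟨key x y hxy, ?_⟩
    have inv : ∀ x : Fin 2 × Bool, φ (mk [(x.1, !x.2)]) = (φ (mk [x]))⁻¹ := by
      intro x
      rw [← map_inv, inv_mk]; rfl
    have h2 := key (y.1, !y.2) (x.1, !x.2) (Ne.symm hxy)
    rw [inv, inv, ← mul_inv_rev, norm_inv_eq, norm_inv_eq] at h2
    exact h2

set_option maxHeartbeats 1000000 in
lemma Minimal.N2 {φ : MulAut F} (hφ : Minimal φ) (x y z : Fin 2 × Bool) (hxy : ok x y)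
    (hyz : ok y z) :
      gp (φ (mk [x]))⁻¹ (φ (mk [y])) + gp (φ (mk [y]))⁻¹ (φ (mk [z])) <
        FreeGroup.norm (φ (mk [y])) := by
  have a1 := hφ.N1 x y hxy
  have a2 := hφ.N1 y z hyz
  have b1 := norm_gp (φ (mk [x]))⁻¹ (φ (mk [y]))
  have b2 := norm_gp (φ (mk [y]))⁻¹ (φ (mk [z]))
  have b3 := norm_gp (φ (mk [y]))⁻¹ (φ (mk [y]))
  have b4 := norm_sq _ (letter_ne φ y)
  rw [inv_inv, norm_inv_eq] at b1 b2 b3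
  by_contra hcon
  by_cases h1 : x.1 = y.1
  · have : x = y := Prod.ext h1 (hxy h1)
    subst this
    omega
  by_cases h2 : y.1 = z.1
  · have : y = z := Prod.ext h2 (hyz h2)
    subst this
    omega
  have hxz : x.1 = z.1 := by omega
  by_cases h3 : x.2 = z.2
  · have : x = z := Prod.ext hxz h3
    subst this
    have hp := fun s => hφ.pair x y h1 s
    set X := φ (mk [x])
    set Y := φ (mk [y])
    obtain ⟨k, hk⟩ : ∃ k, gp X⁻¹ Y = k := ⟨_, rfl⟩
    have hk2 : gp Y⁻¹ X = k := by omega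
    have hY : FreeGroup.norm Y = k + k := by omega
    have hX : k + k ≤ FreeGroup.norm X := by omega
    obtain ⟨p, s, hps, hpn, hsn⟩ := split Y k k hY
    have c1 := norm_gp Y p
    have e1 : Y⁻¹ * p = s⁻¹ := by rw [hps]; group
    rw [e1, norm_inv_eq] at c1
    have c2 := norm_gp Y⁻¹ s⁻¹
    have e2 : Y⁻¹⁻¹ * s⁻¹ = p := by rw [hps]; group
    rw [e2, norm_inv_eq, norm_inv_eq] at c2
    have d1 : k ≤ gp X⁻¹ p := by
      rcases gp_hyp X⁻¹ Y p with h | h <;> omega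
    have d2 : k ≤ gp X s⁻¹ := by
      have := gp_comm Y⁻¹ X
      rcases gp_hyp X Y⁻¹ s⁻¹ with h | h <;> omega
    have f1 := norm_gp s⁻¹ X
    rw [inv_inv, norm_inv_eq, gp_comm] at f1
    have f2 := norm_gp (s * X)⁻¹ X⁻¹
    have e3 : (s * X)⁻¹⁻¹ * X⁻¹ = s := by group
    rw [e3, norm_inv_eq, norm_inv_eq] at f2
    have f3 := norm_gp (s * X)⁻¹ p
    rw [inv_inv, norm_inv_eq] at f3
    have f4 := norm_mul_le s X
    have f5 := norm_gp X⁻¹ p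
    have f6 := norm_mul_le s p
    have f7 := hp s
    have e4 : s * (X * Y) * s⁻¹ = s * X * p := by rw [hps]; group
    have e5 : s * Y * s⁻¹ = s * p := by rw [hps]; group
    have e6 : FreeGroup.norm X ≤ FreeGroup.norm (s * X) + k := by
      have := norm_mul_le s⁻¹ (s * X)
      rw [inv_mul_cancel_left, norm_inv_eq] at this
      omega
    rw [e4, e5] at f7
    have hk0 : 0 < k := by
      rcases Nat.eq_zero_or_pos k with h | h
      · exfalso
        apply letter_ne φ y
        apply FreeGroup.norm_eq_zero.mp
        change FreeGroup.norm Y = 0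
        omega
      · exact h
    rcases gp_hyp (s * X)⁻¹ X⁻¹ p with h | h <;> omega
  · have hz : φ (mk [z]) = (φ (mk [x]))⁻¹ := by
      rw [← map_inv, inv_mk]
      congr 1
      have : z = (x.1, !x.2) := by
        apply Prod.ext
        · exact hxz.symm
        · change z.2 = !x.2
          revert h3
          cases x.2 <;> cases z.2 <;> simp
      rw [this]; rfl
    rw [hz] at b2 hcon a2
    rw [norm_inv_eq] at b2 a2
    rcases gp_hyp (φ (mk [y]))⁻¹ (φ (mk [x]))⁻¹ (φ (mk [y])) with h | h <;> omega

lemma Minimal.small {φ : MulAut F} (hφ : Minimal φ) (i : Fin 2) :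
    FreeGroup.norm (φ (of i)) = 1 := by
  have hpos : FreeGroup.norm (φ (of i)) ≠ 0 := by
    rw [Ne, FreeGroup.norm_eq_zero]; exact letter_ne φ (i, true)
  by_contra hne
  -- the exponent of the letter `i`
  let f : F →* Multiplicative ℤ :=
    FreeGroup.lift (fun j => if j = i then Multiplicative.ofAdd 1 else 1)
  have hf : ∀ l : List (Fin 2 × Bool), (∀ x ∈ l, x.1 ≠ i) → f (mk l) = 1 := by
    intro l
    induction l with
    | nil => intro _; rw [← one_eq_mk, map_one]
    | cons x l ih =>
      intro h
      have e : mk (x :: l) = mk [x] * mk l := by rw [mul_mk]; rfl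
      rw [e, map_mul, ih (fun y hy => h y (by simp [hy])), mul_one]
      have hx := h x (by simp)
      obtain ⟨j, b⟩ := x
      cases b
      · rw [mk_false, map_inv]; simp at hx; simp [f, hx]
      · rw [mk_true]; simp at hx; simp [f, hx]
  have key : ∀ j, f (φ⁻¹ (of j)) = 1 := by
    intro j
    rw [← mk_toWord (x := φ⁻¹ (of j))]
    apply hf
    intro x hx hxi
    rcases hL : (φ⁻¹ (of j)).toWord with _ | ⟨y, l⟩
    · rw [hL] at hx; simp at hx
    · have hr : FreeGroup.IsReduced (y :: l) := hL ▸ isReduced_toWord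
      have := (reduced_norm φ hφ.N1 hφ.N2 l y hr).1 x (hL ▸ hx)
      rw [← hL, mk_toWord, norm_letter, hxi, MulAut.apply_inv_self, norm_of] at this
      omega
  have h1 : f.comp (φ⁻¹ : MulAut F).toMonoidHom = 1 := by
    ext j; simpa using congrArg Multiplicative.toAdd (key j)
  have h2 := DFunLike.congr_fun h1 (φ (of i))
  have h3 : f (of i) = 1 := by simpa using h2
  simp [f] at h3

lemma Minimal.mem {φ : MulAut F} (hφ : Minimal φ) : φ ∈ E := by
  have one : ∀ g : F, FreeGroup.norm g = 1 → ∃ x, g = mk [x] := by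
    intro g hg
    obtain ⟨x, hx⟩ := List.length_eq_one_iff.mp hg
    exact ⟨x, by rw [← hx, mk_toWord]⟩
  obtain ⟨x, hx⟩ := one _ (hφ.small 0)
  obtain ⟨y, hy⟩ := one _ (hφ.small 1)
  by_cases h : x.1 = y.1
  · exfalso
    by_cases h2 : x.2 = y.2
    · have : x = y := Prod.ext h h2
      rw [this, ← hy] at hx
      have := φ.injective hx
      have := of_injective this
      simp at this
    · have e : mk [y] = (mk [x])⁻¹ := by
        have : y = (x.1, !x.2) := by
          apply Prod.ext
          · exact h.symm
          · change y.2 = !x.2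
            revert h2
            cases x.2 <;> cases y.2 <;> simp
        rw [this, inv_mk]; rfl
      rw [e, ← hx, ← map_inv] at hy
      have := congrArg toWord (φ.injective hy)
      simp [toWord_inv, invRev] at this
  · obtain ⟨π, hπ, h0, h1⟩ := signed x y h
    have : φ = π := aut_ext (hx.trans h0.symm) (hy.trans h1.symm)
    rwa [this]

lemma mem_E (φ : MulAut F) : φ ∈ E := by
  induction hn : meas φ using Nat.strong_induction_on generalizing φ with
  | _ n ih =>
    by_cases h : Minimal φ
    · exact h.mem
    · simp only [Minimal] at h
      push Not at h
      obtain ⟨e₁, h₁, e₂, h₂, hlt⟩ := h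
      have := ih _ (hn ▸ hlt) _ rfl
      rwa [Subgroup.mul_mem_cancel_right _ h₂, Subgroup.mul_mem_cancel_left _ h₁] at this

abbrev G := Abelianization F

/-- Generators of the abelianization. -/
abbrev ga (i : Fin 2) : G := Abelianization.of (of i)

/-- Coordinates on the abelianization. -/
noncomputable def co (i : Fin 2) : G →* Multiplicative ℤ :=
  Abelianization.lift (FreeGroup.lift (fun j => if j = i then Multiplicative.ofAdd 1 else 1))

lemma co_ga (i j : Fin 2) : co i (ga j) = if j = i then Multiplicative.ofAdd 1 else 1 := by
  simp [co]

lemma recon (g : G) : g = ga 0 ^ (co 0 g).toAdd * ga 1 ^ (co 1 g).toAdd := by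
  have : MonoidHom.id G =
      (zpowersHom G (ga 0)).comp (co 0) * (zpowersHom G (ga 1)).comp (co 1) := by
    apply Abelianization.hom_ext
    ext i
    fin_cases i <;> simp [co, zpowersHom_apply]
  exact DFunLike.congr_fun this g

lemma linAb_ga (φ : MulAut F) (j : Fin 2) : linAb F φ (ga j) = Abelianization.of (φ (of j)) := by
  simp [linAb, abelianizationCongr', ga]

/-- The matrix of an automorphism of the abelianization. -/
noncomputable def Mat : MulAut G →* Matrix (Fin 2) (Fin 2) ℤ where
  toFun ψ := Matrix.of fun i j => (co i (ψ (ga j))).toAdd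
  map_one' := by
    ext i j
    fin_cases i <;> fin_cases j <;> simp [co_ga]
  map_mul' ψ ψ' := by
    ext i j
    have h := congrArg (fun g => (co i (ψ g)).toAdd) (recon (ψ' (ga j)))
    simp only [map_mul, map_zpow, toAdd_mul, toAdd_zpow] at h
    simp only [Matrix.of_apply, MulAut.mul_apply, Matrix.mul_apply, Fin.sum_univ_two]
    rw [h]
    simp [mul_comm]

lemma Mat_apply (ψ : MulAut G) (i j : Fin 2) : Mat ψ i j = (co i (ψ (ga j))).toAdd := rfl

lemma Mat_inj {ψ ψ' : MulAut G} (h : Mat ψ = Mat ψ') : ψ = ψ' := by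
  apply MulEquiv.toMonoidHom_injective
  apply Abelianization.hom_ext
  ext j
  change ψ (ga j) = ψ' (ga j)
  rw [recon (ψ (ga j)), recon (ψ' (ga j)), ← Mat_apply, ← Mat_apply, ← Mat_apply, ← Mat_apply, h]

lemma Mat_sg : Mat (linAb F sg) = !![-1, 0; 0, 1] := by
  ext i j
  rw [Mat_apply, linAb_ga]
  fin_cases i <;> fin_cases j <;> simp [co]

lemma Mat_pp : Mat (linAb F pp) = !![0, 1; 1, 0] := by
  ext i j
  rw [Mat_apply, linAb_ga]
  fin_cases i <;> fin_cases j <;> simp [co]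

lemma Mat_uu : Mat (linAb F uu) = !![1, 0; 1, 1] := by
  ext i j
  rw [Mat_apply, linAb_ga]
  fin_cases i <;> fin_cases j <;> simp [co]

noncomputable def Mu : MulAut G →* (Matrix (Fin 2) (Fin 2) ℤ)ˣ := Mat.toHomUnits

lemma Mu_val (ψ : MulAut G) : (Mu ψ : Matrix (Fin 2) (Fin 2) ℤ) = Mat ψ := rfl

noncomputable def χ₁ : MulAut G →* ℤˣ := (Matrix.detMonoidHom.comp Mat).toHomUnits

lemma χ₁_val (ψ : MulAut G) : (χ₁ ψ : ℤ) = (Mat ψ).det := rfl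

lemma SL_mem (M : Matrix.SpecialLinearGroup (Fin 2) ℤ) :
    ∃ φ, Mat (linAb F φ) = M := by
  let H : Subgroup (Matrix.SpecialLinearGroup (Fin 2) ℤ) :=
    (Mu.comp (linAb F)).range.comap Matrix.SpecialLinearGroup.toGL
  have hH : Subgroup.closure {ModularGroup.S, ModularGroup.T} ≤ H := by
    rw [Subgroup.closure_le]
    rintro x (rfl | rfl)
    · refine ⟨sg * pp, ?_⟩
      ext1
      rw [MonoidHom.comp_apply, Mu_val, map_mul, map_mul, Mat_sg, Mat_pp]
      ext i j
      fin_cases i <;> fin_cases j <;> simp [ModularGroup.S] <;> rfl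
    · refine ⟨pp * uu * pp, ?_⟩
      ext1
      rw [MonoidHom.comp_apply, Mu_val, map_mul, map_mul, map_mul, map_mul, Mat_uu, Mat_pp]
      ext i j
      fin_cases i <;> fin_cases j <;> simp [ModularGroup.T] <;> rfl
  rw [SpecialLinearGroup.SL2Z_generators] at hH
  obtain ⟨φ, hφ⟩ := hH (Subgroup.mem_top M)
  exact ⟨φ, congrArg Units.val hφ⟩

lemma linAb_surj : Function.Surjective (linAb F) := by
  have key : ∀ ψ : MulAut G, (Mat ψ).det = 1 → ∃ φ, linAb F φ = ψ := by
    intro ψ h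
    obtain ⟨φ, hφ⟩ := SL_mem ⟨Mat ψ, h⟩
    exact ⟨φ, Mat_inj hφ⟩
  intro ψ
  rcases Int.units_eq_one_or (χ₁ ψ) with h | h
  · apply key
    rw [← χ₁_val, h]; rfl
  · obtain ⟨φ, hφ⟩ := key (ψ * linAb F sg) (by
      rw [map_mul, Matrix.det_mul, Mat_sg, ← χ₁_val, h]; simp)
    refine ⟨φ * sg⁻¹, ?_⟩
    rw [map_mul, hφ, map_inv]; group

/-- Sign of an element of `GL₂(𝔽₂) ≅ S₃`. -/
def sgn2 (p q r s : ZMod 2) : ZMod 2 := (1 + p + s) * (q + r + q * r)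

lemma sgn2_mul : ∀ p q r s p' q' r' s' : ZMod 2, p * s - q * r ≠ 0 → p' * s' - q' * r' ≠ 0 →
    sgn2 (p * p' + q * r') (p * q' + q * s') (r * p' + s * r') (r * q' + s * s') =
      sgn2 p q r s + sgn2 p' q' r' s' := by
  unfold sgn2
  decide

lemma det_ne (ψ : MulAut G) : (Mat ψ 0 0 : ZMod 2) * (Mat ψ 1 1) - (Mat ψ 0 1) * (Mat ψ 1 0) ≠ 0 := by
  have h : ((Mat ψ).det : ZMod 2) ≠ 0 := by
    rw [← χ₁_val]
    rcases Int.units_eq_one_or (χ₁ ψ) with h | h <;> rw [h] <;> decide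
  rw [Matrix.det_fin_two] at h
  push_cast at h
  exact h

noncomputable def χ₂ : MulAut G →* Multiplicative (ZMod 2) where
  toFun ψ := Multiplicative.ofAdd (sgn2 (Mat ψ 0 0) (Mat ψ 0 1) (Mat ψ 1 0) (Mat ψ 1 1))
  map_one' := by simp [sgn2]
  map_mul' ψ ψ' := by
    rw [← ofAdd_add, ← sgn2_mul _ _ _ _ _ _ _ _ (det_ne ψ) (det_ne ψ')]
    simp [Matrix.mul_apply, Fin.sum_univ_two]

lemma four (c : Abelianization (MulAut F)) :
    c = 1 ∨ c = cl sg ∨ c = cl uu ∨ c = cl (sg * uu) := by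
  obtain ⟨φ, rfl⟩ : ∃ φ, cl φ = c := QuotientGroup.mk_surjective c
  have h : cl φ ∈ Subgroup.closure {cl sg, cl uu} := mem_E φ
  have hs : ∀ n : ℤ, cl sg ^ n = 1 ∨ cl sg ^ n = cl sg := by
    intro n
    rcases Int.even_or_odd' n with ⟨k, rfl | rfl⟩
    · left; rw [zpow_mul, zpow_two, cl_sg, one_zpow]
    · right; rw [zpow_add, zpow_mul, zpow_two, cl_sg, one_zpow, one_mul, zpow_one]
  have hu : ∀ n : ℤ, cl uu ^ n = 1 ∨ cl uu ^ n = cl uu := by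
    intro n
    rcases Int.even_or_odd' n with ⟨k, rfl | rfl⟩
    · left; rw [zpow_mul, zpow_two, cl_uu, one_zpow]
    · right; rw [zpow_add, zpow_mul, zpow_two, cl_uu, one_zpow, one_mul, zpow_one]
  obtain ⟨m, n, hmn⟩ := Subgroup.mem_closure_pair.mp h
  rw [← hmn, map_mul]
  rcases hs m with h1 | h1 <;> rcases hu n with h2 | h2 <;> rw [h1, h2] <;> simp

end AutF2

open AutF2 in
/-- the linearisation map `Aut(F_2) → GL_2(ℤ) = Aut((F_2)_ab)` induces an
isomorphism on abelianizations. -/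
theorem stmt_9 :
    Function.Bijective (Abelianization.map (linAb (FreeGroup (Fin 2)))) := by
  constructor
  · rw [injective_iff_map_eq_one]
    intro c hc
    have h1 := congrArg (Abelianization.lift χ₁) hc
    have h2 := congrArg (Abelianization.lift χ₂) hc
    rw [_root_.map_one] at h1 h2
    have v1 : χ₁ (linAb F sg) = -1 := by
      ext; rw [χ₁_val, Mat_sg]; simp
    have v2 : χ₁ (linAb F uu) = 1 := by
      ext; rw [χ₁_val, Mat_uu]; simp
    have v3 : χ₂ (linAb F uu) = Multiplicative.ofAdd 1 := by
      simp [χ₂, Mat_uu, sgn2]; decide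
    rcases four c with rfl | rfl | rfl | rfl
    · rfl
    · rw [Abelianization.map_of, Abelianization.lift_apply_of, v1] at h1
      exact absurd h1 (by decide)
    · rw [Abelianization.map_of, Abelianization.lift_apply_of, v3] at h2
      exact absurd h2 (by decide)
    · rw [Abelianization.map_of, Abelianization.lift_apply_of, _root_.map_mul, _root_.map_mul,
        v1, v2] at h1
      exact absurd h1 (by decide)
  · intro c
    obtain ⟨ψ, rfl⟩ : ∃ ψ, Abelianization.of ψ = c := QuotientGroup.mk_surjective c
    obtain ⟨φ, rfl⟩ := linAb_surj ψ
    exact ⟨Abelianization.of φ, Abelianization.map_of _ _⟩
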